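/- Let Ω ⊆ ℝ^d be a measurable set of finite Lebesgue measure |Ω|, let J ∈ L¹(ℝ^d) satisfy J(−x) = J(x) for all x and a(x) := ∫_Ω J(x−y) dy ≥ 0 for a.e. x ∈ Ω, and let F : ℝ → ℝ satisfy F(s) ≥ c₁ s² − c₂ for all s ∈ ℝ, where c₁ > ‖J‖_{L¹(ℝ^d)}/2 and c₂ ∈ ℝ. Then for every φ ∈ L²(Ω) such that F∘φ is integrable on Ω one has (1/2)∫_Ω∫_Ω J(x−y)(φ(x)−φ(y))² dx dy + 2∫_Ω F(φ(x)) dx ≥ (2c₁ − ‖J‖_{L¹(ℝ^d)}) ∫_Ω φ(x)² dx − 2c₂|Ω|. -/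

import Mathlib

open MeasureTheory

section ConvolutionKernel

variable {d : ℕ} {Ω : Set (Fin d → ℝ)} {J f : (Fin d → ℝ) → ℝ}

/-- The kernel `J (x - y) * f x` is integrable on `Ω × Ω` for `J` integrable and even and `f`
integrable on `Ω`. -/
theorem integrable_even_kernel_mul_fst (hΩ : MeasurableSet Ω) (hJ : Integrable J)
    (hJsymm : ∀ x, J (-x) = J x) (hf : IntegrableOn f Ω) :
    Integrable (fun p : (Fin d → ℝ) × (Fin d → ℝ) => J (p.1 - p.2) * f p.1)
      ((volume.restrict Ω).prod (volume.restrict Ω)) := by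
  have hconv := (((integrable_indicator_iff hΩ).2 hf).convolution_integrand
    (ContinuousLinearMap.mul ℝ ℝ) hJ).swap
  rw [Measure.prod_restrict]
  refine (hconv.integrableOn (s := Ω ×ˢ Ω)).congr_fun ?_ (hΩ.prod hΩ)
  rintro ⟨x, y⟩ ⟨hx, -⟩
  have hsub : J (y - x) = J (x - y) := by rw [← hJsymm, neg_sub]
  simp [Set.indicator_of_mem hx, hsub, mul_comm]

theorem integral_even_kernel_mul_fst (hΩ : MeasurableSet Ω) (hJ : Integrable J)
    (hJsymm : ∀ x, J (-x) = J x) (hf : IntegrableOn f Ω) :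
    ∫ p, J (p.1 - p.2) * f p.1 ∂((volume.restrict Ω).prod (volume.restrict Ω)) =
      ∫ x in Ω, (∫ y in Ω, J (x - y)) * f x := by
  rw [integral_prod _ (integrable_even_kernel_mul_fst hΩ hJ hJsymm hf)]
  simp only [integral_mul_const]

theorem integral_abs_even_kernel_mul_fst_le (hΩ : MeasurableSet Ω) (hJ : Integrable J)
    (hJsymm : ∀ x, J (-x) = J x) (hf : IntegrableOn f Ω) (hf0 : ∀ x, 0 ≤ f x) :
    ∫ p, |J (p.1 - p.2)| * f p.1 ∂((volume.restrict Ω).prod (volume.restrict Ω)) ≤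
      (∫ z, |J z|) * ∫ x in Ω, f x := by
  have habs : ∀ x, |J (-x)| = |J x| := fun x => by rw [hJsymm]
  have hint := (integrable_even_kernel_mul_fst hΩ hJ.abs habs hf).integral_prod_left
  simp only [integral_mul_const] at hint
  rw [integral_even_kernel_mul_fst hΩ hJ.abs habs hf, ← integral_const_mul]
  refine integral_mono hint (hf.const_mul _) fun x => ?_
  refine mul_le_mul_of_nonneg_right ?_ (hf0 x)
  calc ∫ y in Ω, |J (x - y)| ≤ ∫ y, |J (x - y)| :=
        setIntegral_le_integral (hJ.abs.comp_sub_left x) (ae_of_all _ fun _ => abs_nonneg _)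
    _ = ∫ z, |J z| := integral_sub_left_eq_self (fun z => |J z|) volume x

/-- The quadratic nonlocal energy is bounded below by `-‖J‖₁ ‖φ‖₂²`. -/
theorem neg_mul_integral_sq_le_nonlocal_energy {φ : (Fin d → ℝ) → ℝ} (hΩ : MeasurableSet Ω)
    (hJ : Integrable J) (hJsymm : ∀ x, J (-x) = J x)
    (ha : ∀ᵐ x ∂(volume.restrict Ω), 0 ≤ ∫ y in Ω, J (x - y))
    (hφm : Measurable φ) (hφ2 : IntegrableOn (fun x => φ x ^ 2) Ω) :
    -((∫ z, |J z|) * ∫ x in Ω, φ x ^ 2) ≤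
      (1 / 2 : ℝ) * ∫ x in Ω, ∫ y in Ω, J (x - y) * (φ x - φ y) ^ 2 := by
  set μ := (volume.restrict Ω).prod (volume.restrict Ω) with hμ
  have habs : ∀ x, |J (-x)| = |J x| := fun x => by rw [hJsymm]
  have hsub : ∀ x y, J (y - x) = J (x - y) := fun x y => by rw [← hJsymm, neg_sub]
  let H : (Fin d → ℝ) × (Fin d → ℝ) → ℝ := fun p => J (p.1 - p.2) * φ p.1 ^ 2
  let A : (Fin d → ℝ) × (Fin d → ℝ) → ℝ := fun p => |J (p.1 - p.2)| * φ p.1 ^ 2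
  have hH : Integrable H μ := integrable_even_kernel_mul_fst hΩ hJ hJsymm hφ2
  have hA : Integrable A μ := integrable_even_kernel_mul_fst hΩ hJ.abs habs hφ2
  have hHs : Integrable (fun p => H p.swap) μ := hH.swap
  have hAs : Integrable (fun p => A p.swap) μ := hA.swap
  have hJm : AEStronglyMeasurable (fun p : (Fin d → ℝ) × (Fin d → ℝ) => J (p.1 - p.2)) μ := by
    refine (hJ.aestronglyMeasurable.comp_quasiMeasurePreserving
      (quasiMeasurePreserving_sub volume volume)).mono_ac ?_
    rw [hμ, Measure.prod_restrict]
    exact Measure.absolutelyContinuous_of_le Measure.restrict_le_self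
  have hE : Integrable (fun p : (Fin d → ℝ) × (Fin d → ℝ) =>
      J (p.1 - p.2) * (φ p.1 - φ p.2) ^ 2) μ := by
    refine ((hA.add hAs).const_mul 2).mono' (hJm.mul (by fun_prop)) (ae_of_all _ fun p => ?_)
    have hsq : (φ p.1 - φ p.2) ^ 2 ≤ 2 * (φ p.1 ^ 2 + φ p.2 ^ 2) := by
      nlinarith [sq_nonneg (φ p.1 + φ p.2)]
    simp only [A, Pi.add_apply, Prod.fst_swap, Prod.snd_swap, hsub p.1 p.2, Real.norm_eq_abs,
      abs_mul, abs_sq]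
    nlinarith [mul_le_mul_of_nonneg_left hsq (abs_nonneg (J (p.1 - p.2)))]
  have hpt : ∀ p : (Fin d → ℝ) × (Fin d → ℝ), (H p + H p.swap) - (A p + A p.swap) ≤
      J (p.1 - p.2) * (φ p.1 - φ p.2) ^ 2 := fun p => by
    simp only [H, A, Prod.fst_swap, Prod.snd_swap, hsub p.1 p.2]
    nlinarith [mul_nonneg (sub_nonneg.2 (le_abs_self (J (p.1 - p.2)))) (sq_nonneg (φ p.1 - φ p.2)),
      mul_nonneg (sub_nonneg.2 (le_abs_self (J (p.1 - p.2)))) (sq_nonneg (φ p.1 + φ p.2)),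
      mul_nonneg (sub_nonneg.2 (neg_abs_le (J (p.1 - p.2)))) (sq_nonneg (φ p.1 - φ p.2)),
      mul_nonneg (sub_nonneg.2 (neg_abs_le (J (p.1 - p.2)))) (sq_nonneg (φ p.1 + φ p.2))]
  have hHH : Integrable (fun p => H p + H p.swap) μ := hH.add hHs
  have hAA : Integrable (fun p => A p + A p.swap) μ := hA.add hAs
  have hmono := integral_mono (hHH.sub hAA) hE hpt
  have hsplit : ∫ p, ((H p + H p.swap) - (A p + A p.swap)) ∂μ =
      2 * ∫ p, H p ∂μ - 2 * ∫ p, A p ∂μ := by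
    rw [integral_sub hHH hAA, integral_add hH hHs, integral_add hA hAs,
      hμ, integral_prod_swap H, integral_prod_swap A]
    ring
  have hH0 : 0 ≤ ∫ p, H p ∂μ := by
    rw [integral_even_kernel_mul_fst hΩ hJ hJsymm hφ2]
    refine integral_nonneg_of_ae ?_
    filter_upwards [ha] with x hx using mul_nonneg hx (sq_nonneg _)
  have hA1 : ∫ p, A p ∂μ ≤ (∫ z, |J z|) * ∫ x in Ω, φ x ^ 2 :=
    integral_abs_even_kernel_mul_fst_le hΩ hJ hJsymm hφ2 fun x => sq_nonneg _
  rw [← integral_prod _ hE]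
  have hle := hsplit.symm.trans_le hmono
  linarith

end ConvolutionKernel

/-- Coercivity of the nonlocal free energy under (H1) and (H3):
`(1/2)∫∫ J(x-y)(φ(x)-φ(y))² + 2∫ F(φ) ≥ (2c₁ - ‖J‖₁) ∫ φ² - 2c₂|Ω|`. -/
theorem stmt_4 {d : ℕ} (Ω : Set (Fin d → ℝ)) (hΩ : MeasurableSet Ω)
    (hΩfin : volume Ω < ⊤)
    (J : (Fin d → ℝ) → ℝ) (hJ : Integrable J)
    (hJsymm : ∀ x, J (-x) = J x)
    (ha : ∀ᵐ x ∂(volume.restrict Ω), 0 ≤ ∫ y in Ω, J (x - y))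
    (F : ℝ → ℝ) (c₁ c₂ : ℝ) (hc₁ : (∫ z, |J z|) / 2 < c₁)
    (hF : ∀ s : ℝ, c₁ * s ^ 2 - c₂ ≤ F s)
    (φ : (Fin d → ℝ) → ℝ) (hφm : Measurable φ)
    (hφ2 : IntegrableOn (fun x => φ x ^ 2) Ω)
    (hFφ : IntegrableOn (fun x => F (φ x)) Ω) :
    (2 * c₁ - ∫ z, |J z|) * (∫ x in Ω, φ x ^ 2) - 2 * c₂ * (volume Ω).toReal
      ≤ (1 / 2 : ℝ) * (∫ x in Ω, ∫ y in Ω, J (x - y) * (φ x - φ y) ^ 2)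
        + 2 * ∫ x in Ω, F (φ x) := by
  have henergy := neg_mul_integral_sq_le_nonlocal_energy hΩ hJ hJsymm ha hφm hφ2
  have : IsFiniteMeasure (volume.restrict Ω) := ⟨by simpa using hΩfin⟩
  have hpot : c₁ * (∫ x in Ω, φ x ^ 2) - c₂ * (volume Ω).toReal ≤ ∫ x in Ω, F (φ x) := by
    have hmono := integral_mono ((hφ2.const_mul c₁).sub (integrable_const c₂)) hFφ
      fun x => hF (φ x)
    simp only [Pi.sub_apply] at hmono
    rw [integral_sub (hφ2.const_mul c₁) (integrable_const c₂), integral_const_mul] at hmono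
    simpa [Measure.real, mul_comm] using hmono
  linarith
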